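/- Let h : ℝ² → ℝ be a positively homogeneous function, let E* be a finite upper exhauster of h, and let C₀ ∈ E* be such that E* \ {C₀} is nonempty. If the family E* \ {C₀} is NOT an upper exhauster of h, then there exist θ₁, θ₂ ∈ [0, 2π] with θ₁ < θ₂ such that for all θ ∈ [θ₁, θ₂] one has ρ_{C₀}(θ) = ρ(θ) and moreover ρ_{C₀}(θ) < ρ_C(θ) for every C ∈ E* \ {C₀}, where ρ(θ) = min_{C ∈ E*} ρ_C(θ). -/

import Mathlib

open Set Real
open scoped RealInnerProductSpace

noncomputable def suppFn (C : Set (EuclideanSpace ℝ (Fin 2))) (g : EuclideanSpace ℝ (Fin 2)) : ℝ :=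
  sSup ((fun v => ⟪v, g⟫) '' C)

def IsUpperExhauster (h : EuclideanSpace ℝ (Fin 2) → ℝ)
    (E : Set (Set (EuclideanSpace ℝ (Fin 2)))) : Prop :=
  (∀ C ∈ E, C.Nonempty ∧ IsCompact C ∧ Convex ℝ C) ∧
  ∀ g, IsGLB ((fun C => suppFn C g) '' E) (h g)

noncomputable def udir (θ : ℝ) : EuclideanSpace ℝ (Fin 2) :=
  (EuclideanSpace.equiv (Fin 2) ℝ).symm ![Real.cos θ, Real.sin θ]

noncomputable def rho (C : Set (EuclideanSpace ℝ (Fin 2))) (θ : ℝ) : ℝ := suppFn C (udir θ)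

lemma suppFn_zero {C : Set (EuclideanSpace ℝ (Fin 2))} (hC : C.Nonempty) : suppFn C 0 = 0 := by
  simp [suppFn, hC.image_const]

open scoped Pointwise in
lemma suppFn_smul (C : Set (EuclideanSpace ℝ (Fin 2))) {r : ℝ} (hr : 0 ≤ r)
    (g : EuclideanSpace ℝ (Fin 2)) : suppFn C (r • g) = r * suppFn C g := by
  have : (fun v => ⟪v, r • g⟫) '' C = r • ((fun v => ⟪v, g⟫) '' C) := by
    rw [← Set.image_smul, Set.image_image]
    simp only [real_inner_smul_right, smul_eq_mul]
  rw [suppFn, suppFn, this, Real.sSup_smul_of_nonneg hr, smul_eq_mul]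

lemma continuous_rho {C : Set (EuclideanSpace ℝ (Fin 2))} (hC : IsCompact C) :
    Continuous (rho C) := by
  have h_udir : Continuous udir := by
    unfold udir
    refine (EuclideanSpace.equiv (Fin 2) ℝ).symm.continuous.comp (continuous_pi fun i => ?_)
    fin_cases i
    · exact Real.continuous_cos
    · exact Real.continuous_sin
  have h_supp : Continuous (suppFn C) :=
    hC.continuous_sSup (f := fun g v => ⟪v, g⟫) (by
      simp only [Function.HasUncurry.uncurry]
      fun_prop)
  exact h_supp.comp h_udir

lemma exists_eq_smul_udir (g : EuclideanSpace ℝ (Fin 2)) :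
    ∃ r : ℝ, 0 ≤ r ∧ ∃ θ ∈ Ico 0 (2 * π), g = r • udir θ := by
  set z : ℂ := ⟨g 0, g 1⟩
  refine ⟨‖z‖, norm_nonneg z, toIcoMod Real.two_pi_pos 0 z.arg, ?_, ?_⟩
  · simpa using toIcoMod_mem_Ico Real.two_pi_pos 0 z.arg
  · have hcos : g 0 = ‖z‖ * cos (toIcoMod Real.two_pi_pos 0 z.arg) := by
      rw [toIcoMod, zsmul_eq_mul, Real.cos_sub_int_mul_two_pi, Complex.norm_mul_cos_arg]
    have hsin : g 1 = ‖z‖ * sin (toIcoMod Real.two_pi_pos 0 z.arg) := by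
      rw [toIcoMod, zsmul_eq_mul, Real.sin_sub_int_mul_two_pi, Complex.norm_mul_sin_arg]
    ext i
    fin_cases i
    · simpa [udir] using hcos
    · simpa [udir] using hsin

lemma forall_lt_of_not_isUpperExhauster {h : EuclideanSpace ℝ (Fin 2) → ℝ}
    {E : Set (Set (EuclideanSpace ℝ (Fin 2)))} {C₀ : Set (EuclideanSpace ℝ (Fin 2))}
    (hE : IsUpperExhauster h E) (hnot : ¬ IsUpperExhauster h (E \ {C₀})) :
    ∃ g, ∀ C ∈ E \ {C₀}, suppFn C₀ g < suppFn C g := by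
  by_contra! hcon
  refine hnot ⟨fun C hC => hE.1 C hC.1, fun g => ⟨?_, fun b hb => (hE.2 g).2 ?_⟩⟩
  · rintro _ ⟨C, hC, rfl⟩
    exact (hE.2 g).1 ⟨C, hC.1, rfl⟩
  · obtain ⟨C₁, hC₁, hle⟩ := hcon g
    rintro _ ⟨C, hC, rfl⟩
    by_cases hCC : C = C₀
    · subst hCC
      exact (hb ⟨C₁, hC₁, rfl⟩).trans hle
    · exact hb ⟨C, ⟨hC, hCC⟩, rfl⟩

theorem exists_interval_of_not_exhauster
    (h : EuclideanSpace ℝ (Fin 2) → ℝ)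
    (hph : ∀ (l : ℝ) (g : EuclideanSpace ℝ (Fin 2)), 0 ≤ l → h (l • g) = l * h g)
    (E : Set (Set (EuclideanSpace ℝ (Fin 2)))) (hfin : E.Finite)
    (C₀ : Set (EuclideanSpace ℝ (Fin 2)))
    (hE : IsUpperExhauster h E) (hC₀ : C₀ ∈ E)
    (hne : (E \ {C₀}).Nonempty)
    (hnot : ¬ IsUpperExhauster h (E \ {C₀})) :
    ∃ θ₁ ∈ Icc (0:ℝ) (2 * π), ∃ θ₂ ∈ Icc (0:ℝ) (2 * π), θ₁ < θ₂ ∧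
      ∀ θ ∈ Icc θ₁ θ₂,
        rho C₀ θ = sInf ((fun C => rho C θ) '' E) ∧
        ∀ C ∈ E \ {C₀}, rho C₀ θ < rho C θ := by
  obtain ⟨g, hg⟩ := forall_lt_of_not_isUpperExhauster hE hnot
  obtain ⟨r, hr, θ, hθ, rfl⟩ := exists_eq_smul_udir g
  have hr' : 0 < r := by
    refine hr.lt_of_ne' ?_
    rintro rfl
    obtain ⟨C, hC⟩ := hne
    have := hg C hC
    rw [zero_smul, suppFn_zero (hE.1 C hC.1).1, suppFn_zero (hE.1 C₀ hC₀).1] at this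
    exact this.false
  have hlt : ∀ C ∈ E \ {C₀}, rho C₀ θ < rho C θ := fun C hC => by
    have := hg C hC
    rw [suppFn_smul _ hr, suppFn_smul _ hr] at this
    exact lt_of_mul_lt_mul_left this hr
  have hev : ∀ᶠ θ' in nhds θ, ∀ C ∈ E \ {C₀}, rho C₀ θ' < rho C θ' :=
    (hfin.subset sdiff_subset).eventually_all.2 fun C hC =>
      (continuous_rho (hE.1 C₀ hC₀).2.1).continuousAt.eventually_lt
        (continuous_rho (hE.1 C hC.1).2.1).continuousAt (hlt C hC)
  obtain ⟨ε, hε, hball⟩ := Metric.eventually_nhds_iff.1 hev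
  obtain ⟨θ₂, hθ₂, hθ₂'⟩ := exists_between (lt_min hθ.2 (lt_add_of_pos_right θ hε))
  refine ⟨θ, ⟨hθ.1, hθ.2.le⟩, θ₂,
    ⟨hθ.1.trans hθ₂.le, (hθ₂'.trans_le (min_le_left _ _)).le⟩, hθ₂, fun t ht => ?_⟩
  have hlt' : ∀ C ∈ E \ {C₀}, rho C₀ t < rho C t := hball <| by
    have := hθ₂'.trans_le (min_le_right _ _)
    rw [Real.dist_eq, abs_of_nonneg (sub_nonneg.2 ht.1)]
    linarith [ht.2]
  refine ⟨(IsLeast.csInf_eq ?_).symm, hlt'⟩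
  refine ⟨mem_image_of_mem (fun C => rho C t) hC₀, ?_⟩
  rintro _ ⟨C, hC, rfl⟩
  by_cases hCC : C = C₀
  · rw [hCC]
  · exact (hlt' C ⟨hC, hCC⟩).le
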